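/- There exists an absolute constant c > 0 with the following property. Let n ≥ 2, η > 0, B ≥ 1, and Q a positive integer. Let A(k), k ≥ 0, be a sequence of n×n doubly stochastic matrices with positive diagonal entries whose positive entries are all at least η. Let x(0) ∈ ℝⁿ have all components equal to multiples of 1/Q with V̲(x(0)) > 0 and Q² V̲(x(0)) > 1, let the sequence evolve by the quantized update x_i(k+1) = ⌊Σ_{j=1}^n a_{ij}(k) x_j(k)⌋_{1/Q}, and assume that for every k, after reordering the components of x(kB) in nonincreasing order, for every d ∈ {1,…,n−1} either the d-th and (d+1)-th ordered components of x(kB) are equal, or there exist a time t ∈ {kB,…,(k+1)B−1} and indices i among the d largest-valued nodes and j among the rest such that (i,j) or (j,i) belongs to E(A(t)). Then for all k ≥ c (n²/η) B log(Q² V̲(x(0))), all components of x(k) are equal. -/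

import Mathlib

open Matrix Finset Real Filter

/-- A matrix is doubly stochastic if entrywise nonnegative with all rows and columns summing to 1. -/
def IsDoublyStochastic {n : ℕ} (A : Matrix (Fin n) (Fin n) ℝ) : Prop :=
  (∀ i j, 0 ≤ A i j) ∧ (∀ i, ∑ j, A i j = 1) ∧ (∀ j, ∑ i, A i j = 1)

/-- The average of the components of a vector. -/
noncomputable def avgVec {n : ℕ} (x : Fin n → ℝ) : ℝ := (∑ i, x i) / n

/-- The sample variance V(x) = Σ_i (x_i - x̄)². -/
noncomputable def sampleVar {n : ℕ} (x : Fin n → ℝ) : ℝ := ∑ i, (x i - avgVec x) ^ 2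

/-- The Lyapunov function V̲(x) = Σ_i (x_i - min_j x_j)². -/
noncomputable def underVar {n : ℕ} (x : Fin n → ℝ) : ℝ := ∑ i, (x i - ⨅ j, x j) ^ 2

/-- Σ_{i=1}^{n-1} (x_i - x_{i+1})² for a vector indexed by `Fin n`. -/
noncomputable def sumSqDiff {n : ℕ} (x : Fin n → ℝ) : ℝ :=
  ∑ i : Fin n, if h : (i : ℕ) + 1 < n then (x i - x ⟨(i : ℕ) + 1, h⟩) ^ 2 else 0

/-- Rounding down to the nearest multiple of 1/Q. -/
noncomputable def qfloor (Q : ℕ) (y : ℝ) : ℝ := (⌊(Q : ℝ) * y⌋ : ℝ) / Q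

/-- Doubly stochastic with positive diagonal and all positive entries at least η. -/
def GoodWeights {n : ℕ} (η : ℝ) (A : Matrix (Fin n) (Fin n) ℝ) : Prop :=
  IsDoublyStochastic A ∧ (∀ i, 0 < A i i) ∧ ∀ i j, 0 < A i j → η ≤ A i j

/-- The directed graph with edges `E(A(kB)) ∪ ⋯ ∪ E(A((k+1)B-1))` is strongly connected;
here `(j,i) ∈ E(A)` iff `A i j > 0`. -/
def BlockConnected {n : ℕ} (A : ℕ → Matrix (Fin n) (Fin n) ℝ) (B k : ℕ) : Prop :=
  ∀ u v : Fin n,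
    Relation.ReflTransGen (fun a b => ∃ t, k * B ≤ t ∧ t < (k + 1) * B ∧ 0 < A t b a) u v

/-- Assumption 3 of the paper for the (already sorted) vector `y = x(kB)`: for every cut `d`,
either the d-th and (d+1)-th components are equal, or some edge crosses the cut during
the time block `[kB, (k+1)B)`. -/
def CutCondition {n : ℕ} (A : ℕ → Matrix (Fin n) (Fin n) ℝ) (B k : ℕ) (y : Fin n → ℝ) : Prop :=
  ∀ d : Fin n, ∀ h : (d : ℕ) + 1 < n,
    y d = y ⟨(d : ℕ) + 1, h⟩ ∨
      ∃ t, k * B ≤ t ∧ t < (k + 1) * B ∧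
        ∃ i j : Fin n, i ≤ d ∧ d < j ∧ (0 < A t i j ∨ 0 < A t j i)

/-- Assumption 3 of the paper at time block `k`: after reordering the components of `x`
in nonincreasing order via a permutation `σ`, for every cut `d`, either the d-th and
(d+1)-th ordered components are equal, or some edge crossing the cut appears during the
time block `[kB, (k+1)B)`. -/
def CutConditionPerm {n : ℕ} (A : ℕ → Matrix (Fin n) (Fin n) ℝ) (B k : ℕ)
    (x : Fin n → ℝ) : Prop :=
  ∃ σ : Equiv.Perm (Fin n), Antitone (x ∘ σ) ∧
    ∀ d : Fin n, ∀ h : (d : ℕ) + 1 < n,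
      x (σ d) = x (σ ⟨(d : ℕ) + 1, h⟩) ∨
        ∃ t, k * B ≤ t ∧ t < (k + 1) * B ∧
          ∃ i j : Fin n, i ≤ d ∧ d < j ∧ (0 < A t (σ i) (σ j) ∨ 0 < A t (σ j) (σ i))


noncomputable def stp {n : ℕ} (d : ℕ) (i : Fin n) : ℝ := if (i : ℕ) ≤ d then 1 else 0

def Crs {n : ℕ} (A : Matrix (Fin n) (Fin n) ℝ) (d : ℕ) : Prop :=
  ∃ i j : Fin n, (i : ℕ) ≤ d ∧ d < (j : ℕ) ∧ (0 < A i j ∨ 0 < A j i)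

lemma var_id {n : ℕ} (a y : Fin n → ℝ) (ha : ∑ i, a i = 1) :
    ∑ i, ∑ j, a i * a j * (y i - y j) ^ 2 = 2 * (∑ i, a i * y i ^ 2 - (∑ i, a i * y i) ^ 2) := by
  have h1 : ∀ i j, a i * a j * (y i - y j) ^ 2
      = (a i * y i ^ 2) * a j + a i * (a j * y j ^ 2) - 2 * ((a i * y i) * (a j * y j)) := by
    intro i j; ring
  simp only [h1, Finset.sum_sub_distrib, Finset.sum_add_distrib, ← Finset.mul_sum,
    ← Finset.sum_mul, ha]
  ring

lemma stp_var {n : ℕ} {η : ℝ} (A : Matrix (Fin n) (Fin n) ℝ) (hA : GoodWeights η A)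
    (hη : 0 < η) (d : ℕ) (hc : Crs A d) :
    η / 2 ≤ ∑ l, (∑ i, A l i * stp d i ^ 2 - (∑ i, A l i * stp d i) ^ 2) := by
  obtain ⟨⟨hnn, hrow, hcol⟩, hdiag, hpos⟩ := hA
  have hs2 : ∀ i : Fin n, stp d i ^ 2 = stp d i := by
    intro i; unfold stp; split_ifs <;> norm_num
  have hs0 : ∀ i : Fin n, 0 ≤ stp d i := by
    intro i; unfold stp; split_ifs <;> norm_num
  have hs1 : ∀ i : Fin n, stp d i ≤ 1 := by
    intro i; unfold stp; split_ifs <;> norm_num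
  simp only [hs2]
  have hp0 : ∀ l, 0 ≤ ∑ i, A l i * stp d i := fun l =>
    Finset.sum_nonneg fun i _ => mul_nonneg (hnn l i) (hs0 i)
  have hq : ∀ l, 1 - ∑ i, A l i * stp d i = ∑ i, A l i * (1 - stp d i) := by
    intro l; simp only [mul_sub, Finset.sum_sub_distrib, mul_one, hrow]
  have hq0 : ∀ l, 0 ≤ ∑ i, A l i * (1 - stp d i) := fun l =>
    Finset.sum_nonneg fun i _ => mul_nonneg (hnn l i) (by linarith [hs1 i])
  have key : ∀ l i j : Fin n, (i : ℕ) ≤ d → d < (j : ℕ) → 0 < A l i → 0 < A l j →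
      η / 2 ≤ ∑ l, (∑ i, A l i * stp d i - (∑ i, A l i * stp d i) ^ 2) := by
    intro l i j hi hj hli hlj
    have e1 : η ≤ ∑ i, A l i * stp d i := by
      have := Finset.single_le_sum (f := fun i => A l i * stp d i)
        (fun i _ => mul_nonneg (hnn l i) (hs0 i)) (Finset.mem_univ i)
      have h2 := hpos l i hli
      simp only [stp, hi, if_true, mul_one] at this ⊢
      linarith
    have e2 : η ≤ ∑ i, A l i * (1 - stp d i) := by
      have := Finset.single_le_sum (f := fun i => A l i * (1 - stp d i))
        (fun i _ => mul_nonneg (hnn l i) (by linarith [hs1 i])) (Finset.mem_univ j)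
      have h2 := hpos l j hlj
      have h3 : stp d j = 0 := by simp [stp, hj]
      simp only [h3, sub_zero, mul_one] at this
      linarith
    rw [← hq] at e2
    have e3 : η / 2 ≤ ∑ i, A l i * stp d i - (∑ i, A l i * stp d i) ^ 2 := by
      nlinarith
    refine e3.trans (Finset.single_le_sum (f := fun l => ∑ i, A l i * stp d i -
      (∑ i, A l i * stp d i) ^ 2) (fun l _ => ?_) (Finset.mem_univ l))
    have a1 := hp0 l
    have a2 := hq0 l
    rw [← hq] at a2
    show 0 ≤ ∑ i, A l i * stp d i - (∑ i, A l i * stp d i) ^ 2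
    nlinarith
  obtain ⟨i, j, hi, hj, h | h⟩ := hc
  · exact key i i j hi hj (hdiag i) h
  · exact key j i j hi hj h (hdiag j)

lemma core {n : ℕ} {η : ℝ} (A : Matrix (Fin n) (Fin n) ℝ) (hA : GoodWeights η A)
    (hη : 0 < η) (y : Fin n → ℝ) (D : Finset ℕ) (g : ℕ → ℝ)
    (hp : ∀ i j, ∑ d ∈ D, g d ^ 2 * (stp d i - stp d j) ^ 2 ≤ (y i - y j) ^ 2)
    (hc : ∀ d ∈ D, Crs A d) :
    η / 2 * ∑ d ∈ D, g d ^ 2 ≤ ∑ i, y i ^ 2 - ∑ i, (A.mulVec y i) ^ 2 := by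
  obtain ⟨⟨hnn, hrow, hcol⟩, hdiag, hpos⟩ := id hA
  have h1 : ∑ i, y i ^ 2 - ∑ i, (A.mulVec y i) ^ 2
      = ∑ l, (∑ i, A l i * y i ^ 2 - (∑ i, A l i * y i) ^ 2) := by
    rw [Finset.sum_sub_distrib, Finset.sum_comm]
    simp only [← Finset.sum_mul, hcol, one_mul]
    rfl
  have h2 : ∀ l, ∑ d ∈ D, g d ^ 2 * (∑ i, A l i * stp d i ^ 2 - (∑ i, A l i * stp d i) ^ 2)
      ≤ ∑ i, A l i * y i ^ 2 - (∑ i, A l i * y i) ^ 2 := by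
    intro l
    have e1 := var_id (A l) y (hrow l)
    have e2 : ∑ i, ∑ j, A l i * A l j * (∑ d ∈ D, g d ^ 2 * (stp d i - stp d j) ^ 2)
        = ∑ d ∈ D, g d ^ 2 * (2 * (∑ i, A l i * stp d i ^ 2 - (∑ i, A l i * stp d i) ^ 2)) := by
      simp only [← var_id (A l) _ (hrow l), Finset.mul_sum]
      rw [Finset.sum_comm]
      rw [Finset.sum_congr rfl (fun j _ => Finset.sum_comm)]
      rw [Finset.sum_comm]
      refine Finset.sum_congr rfl fun d _ => ?_
      rw [Finset.sum_comm]
      refine Finset.sum_congr rfl fun i _ => ?_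
      refine Finset.sum_congr rfl fun j _ => ?_
      ring
    have e3 : ∑ i, ∑ j, A l i * A l j * (∑ d ∈ D, g d ^ 2 * (stp d i - stp d j) ^ 2)
        ≤ ∑ i, ∑ j, A l i * A l j * (y i - y j) ^ 2 := by
      refine Finset.sum_le_sum fun i _ => Finset.sum_le_sum fun j _ => ?_
      exact mul_le_mul_of_nonneg_left (hp i j) (mul_nonneg (hnn l i) (hnn l j))
    rw [e1, e2] at e3
    have e4 : ∑ d ∈ D, g d ^ 2 * (2 * (∑ i, A l i * stp d i ^ 2 - (∑ i, A l i * stp d i) ^ 2))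
      = 2 * ∑ d ∈ D, g d ^ 2 * (∑ i, A l i * stp d i ^ 2 - (∑ i, A l i * stp d i) ^ 2) := by
      rw [Finset.mul_sum]; refine Finset.sum_congr rfl fun d _ => ?_
      ring
    linarith
  rw [h1]
  refine le_trans ?_ (Finset.sum_le_sum fun l _ => h2 l)
  rw [Finset.sum_comm, Finset.mul_sum]
  refine Finset.sum_le_sum fun d hd => ?_
  rw [← Finset.mul_sum, mul_comm]
  exact mul_le_mul_of_nonneg_left (stp_var A hA hη d (hc d hd)) (sq_nonneg _)

lemma gap_sum (v : ℕ → ℝ) (hv : Antitone v) (D : Finset ℕ) (a b : ℕ)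
    (hD : D ⊆ Finset.Ico a b) (hab : a ≤ b) :
    ∑ d ∈ D, (v d - v (d + 1)) ≤ v a - v b := by
  have h1 : ∑ d ∈ D, (v d - v (d + 1)) ≤ ∑ d ∈ Finset.Ico a b, (v d - v (d + 1)) :=
    Finset.sum_le_sum_of_subset_of_nonneg hD fun d _ _ => by linarith [hv (Nat.le_succ d)]
  have h2 : ∑ d ∈ Finset.Ico a b, (v d - v (d + 1)) = v a - v b := by
    have := Finset.sum_Ico_sub (fun d => - v d) hab
    have e : ∑ d ∈ Finset.Ico a b, (v d - v (d + 1)) = ∑ d ∈ Finset.Ico a b, (-v (d + 1) - -v d) :=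
      Finset.sum_congr rfl fun d _ => by ring
    rw [e, this]; ring
  linarith

lemma pair_le {n : ℕ} (v : ℕ → ℝ) (hv : Antitone v) (D : Finset ℕ) (y : Fin n → ℝ)
    (h1 : ∀ d ∈ D, ∀ i : Fin n, (i : ℕ) ≤ d → v d ≤ y i)
    (h2 : ∀ d ∈ D, ∀ i : Fin n, d < (i : ℕ) → y i ≤ v (d + 1)) (i j : Fin n) :
    ∑ d ∈ D, (v d - v (d + 1)) ^ 2 * (stp d i - stp d j) ^ 2 ≤ (y i - y j) ^ 2 := by
  have main : ∀ i j : Fin n, i ≤ j →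
      ∑ d ∈ D, (v d - v (d + 1)) ^ 2 * (stp d i - stp d j) ^ 2 ≤ (y i - y j) ^ 2 := by
    intro i j hij
    have hij' : (i : ℕ) ≤ j := hij
    have e1 : ∑ d ∈ D, (v d - v (d + 1)) ^ 2 * (stp d i - stp d j) ^ 2
        = ∑ d ∈ D.filter (fun d => (i : ℕ) ≤ d ∧ d < (j : ℕ)), (v d - v (d + 1)) ^ 2 := by
      rw [Finset.sum_filter]
      refine Finset.sum_congr rfl fun d _ => ?_
      unfold stp
      split_ifs <;> first | omega | simp
    rw [e1]
    set F := D.filter (fun d => (i : ℕ) ≤ d ∧ d < (j : ℕ)) with hF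
    rcases F.eq_empty_or_nonempty with h | h
    · rw [h]; simp; positivity
    · have m1 := Finset.min'_mem F h
      have m2 := Finset.max'_mem F h
      have hsub : F ⊆ Finset.Ico (F.min' h) (F.max' h + 1) := by
        intro d hd
        rw [Finset.mem_Ico]
        exact ⟨Finset.min'_le F d hd, Nat.lt_succ_of_le (Finset.le_max' F d hd)⟩
      have hle := gap_sum v hv F _ _ hsub ((Finset.min'_le F _ m2).trans (Nat.le_succ _))
      replace m1 := Finset.mem_filter.1 m1
      replace m2 := Finset.mem_filter.1 m2
      have a1 := h1 _ m1.1 i m1.2.1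
      have a2 := h2 _ m2.1 j m2.2.2
      have hg : ∀ d ∈ F, 0 ≤ v d - v (d + 1) := fun d _ => by linarith [hv (Nat.le_succ d)]
      have s1 := Finset.sum_sq_le_sq_sum_of_nonneg hg
      have s0 := Finset.sum_nonneg hg
      refine s1.trans ?_
      apply pow_le_pow_left₀ s0
      linarith
  rcases le_total i j with h | h
  · exact main i j h
  · have := main j i h
    rw [show (y i - y j) ^ 2 = (y j - y i) ^ 2 by ring]
    convert this using 2
    ring

lemma inf_le' {n : ℕ} (y : Fin n → ℝ) (i : Fin n) : ⨅ j, y j ≤ y i :=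
  ciInf_le (Set.finite_range y).bddBelow i

lemma inf_attained {n : ℕ} (hn : 2 ≤ n) (y : Fin n → ℝ) : ∃ i, y i = ⨅ j, y j := by
  have : Nonempty (Fin n) := ⟨⟨0, by omega⟩⟩
  exact exists_eq_ciInf_of_finite

/-- one step decrease -/
lemma step {n : ℕ} (hn : 2 ≤ n) {η : ℝ} (A : Matrix (Fin n) (Fin n) ℝ) (hA : GoodWeights η A)
    (hη : 0 < η) (z z' : Fin n → ℤ)
    (hz : ∀ i, z' i = ⌊A.mulVec (fun j => (z j : ℝ)) i⌋)
    (D : Finset ℕ) (g : ℕ → ℝ)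
    (hp : ∀ i j, ∑ d ∈ D, g d ^ 2 * (stp d i - stp d j) ^ 2 ≤ ((z i : ℝ) - z j) ^ 2)
    (hc : ∀ d ∈ D, Crs A d) :
    underVar (fun i => (z' i : ℝ)) + η / 2 * ∑ d ∈ D, g d ^ 2 ≤ underVar (fun i => (z i : ℝ)) := by
  obtain ⟨⟨hnn, hrow, hcol⟩, hdiag, hpos⟩ := id hA
  obtain ⟨i0, h0⟩ := inf_attained hn (fun i => (z i : ℝ))
  obtain ⟨i1, h1⟩ := inf_attained hn (fun i => (z' i : ℝ))
  have hmin : ∀ i, z i0 ≤ z i := fun i => by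
    have := inf_le' (fun i => (z i : ℝ)) i
    rw [← h0] at this
    exact_mod_cast this
  have hmv : ∀ i, A.mulVec (fun j => (z j : ℝ) - z i0) i
      = A.mulVec (fun j => (z j : ℝ)) i - z i0 := by
    intro i
    simp only [Matrix.mulVec, dotProduct, mul_sub, Finset.sum_sub_distrib, ← Finset.sum_mul, hrow,
      one_mul]
  have hge : ∀ i, 0 ≤ A.mulVec (fun j => (z j : ℝ) - z i0) i := by
    intro i
    show 0 ≤ ∑ j, A i j * ((z j : ℝ) - z i0)
    refine Finset.sum_nonneg fun j _ => mul_nonneg (hnn i j) ?_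
    have : (z i0 : ℝ) ≤ z j := by exact_mod_cast hmin j
    linarith
  have hz'0 : ∀ i, z i0 ≤ z' i := by
    intro i
    rw [hz, Int.le_floor]
    linarith [hge i, hmv i]
  have hz'1 : ∀ i, (z' i : ℝ) ≤ A.mulVec (fun j => (z j : ℝ)) i := by
    intro i; rw [hz]; exact Int.floor_le _
  have hco := core A hA hη (fun j => (z j : ℝ) - z i0) D g
    (fun i j => by simpa using hp i j) hc
  have hlt : underVar (fun i => (z' i : ℝ)) ≤
      ∑ i, (A.mulVec (fun j => (z j : ℝ) - z i0) i) ^ 2 := by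
    unfold underVar
    refine Finset.sum_le_sum fun i _ => ?_
    have b1 := inf_le' (fun i => (z' i : ℝ)) i
    have b2 : (z i0 : ℝ) ≤ z' i1 := by exact_mod_cast hz'0 i1
    have b3 := hz'1 i
    apply pow_le_pow_left₀
    · linarith
    · rw [hmv, ← h1]; linarith
  have hu : underVar (fun i => (z i : ℝ)) = ∑ i, ((z i : ℝ) - z i0) ^ 2 := by
    unfold underVar; rw [← h0]
  rw [hu]
  linarith

/-- sorted block lemma -/
lemma block {n : ℕ} (hn : 2 ≤ n) {η : ℝ} (hη : 0 < η) (B : ℕ)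
    (A : ℕ → Matrix (Fin n) (Fin n) ℝ) (hA : ∀ k, GoodWeights η (A k))
    (z : ℕ → Fin n → ℤ) (hz : ∀ k i, z (k + 1) i = ⌊(A k).mulVec (fun j => (z k j : ℝ)) i⌋)
    (hs : Antitone (z 0))
    (hcut : ∀ d : Fin n, ∀ h : (d : ℕ) + 1 < n, z 0 d = z 0 ⟨(d : ℕ) + 1, h⟩ ∨
      ∃ t, t < B ∧ Crs (A t) d) :
    underVar (fun i => (z B i : ℝ)) ≤
      (1 - η / (2 * n ^ 2)) * underVar (fun i => (z 0 i : ℝ)) := by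
  classical
  let w : ℕ → ℤ := fun m => z 0 ⟨min m (n - 1), by omega⟩
  have hw : Antitone w := by
    intro a b hab
    apply hs
    rw [Fin.mk_le_mk]; omega
  have hwi : ∀ i : Fin n, w i = z 0 i := by
    intro i
    show z 0 _ = _
    congr 1
    ext
    show min (i : ℕ) (n - 1) = i
    have := i.2
    omega
  let v : ℕ → ℝ := fun m => (w m : ℝ)
  have hv : Antitone v := fun a b hab => by
    show (w b : ℝ) ≤ w a
    exact_mod_cast hw hab
  -- invariant
  have inv : ∀ t d, (∀ s < t, ¬ Crs (A s) d) →
      (∀ i : Fin n, (i : ℕ) ≤ d → w d ≤ z t i) ∧ (∀ i : Fin n, d < (i : ℕ) → z t i ≤ w (d + 1)) := by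
    intro t d
    induction t with
    | zero =>
      intro _
      refine ⟨fun i hi => ?_, fun i hi => ?_⟩
      · rw [← hwi]; exact hw hi
      · rw [← hwi]; exact hw hi
    | succ t ih =>
      intro hno
      obtain ⟨ih1, ih2⟩ := ih fun s hs => hno s (by omega)
      have hn0 := hno t (by omega)
      obtain ⟨⟨hnn, hrow, hcol⟩, hdiag, hpos⟩ := hA t
      have hz1 : ∀ i j : Fin n, (i : ℕ) ≤ d → d < (j : ℕ) → A t i j = 0 ∧ A t j i = 0 := by
        intro i j hi hj
        constructor
        · by_contra hne
          exact hn0 ⟨i, j, hi, hj, Or.inl (lt_of_le_of_ne (hnn i j) (Ne.symm hne))⟩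
        · by_contra hne
          exact hn0 ⟨i, j, hi, hj, Or.inr (lt_of_le_of_ne (hnn j i) (Ne.symm hne))⟩
      refine ⟨fun i hi => ?_, fun i hi => ?_⟩
      · rw [hz, Int.le_floor]
        calc (w d : ℝ) = ∑ j, A t i j * w d := by rw [← Finset.sum_mul, hrow, one_mul]
          _ ≤ ∑ j, A t i j * z t j := by
            refine Finset.sum_le_sum fun j _ => ?_
            rcases le_or_gt (j : ℕ) d with h | h
            · exact mul_le_mul_of_nonneg_left (by exact_mod_cast ih1 j h) (hnn i j)
            · rw [(hz1 i j hi h).1]; simp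
      · have : ((z (t + 1) i : ℤ) : ℝ) ≤ w (d + 1) := by
          rw [hz]
          refine (Int.floor_le _).trans ?_
          calc ∑ j, A t i j * (z t j : ℝ) ≤ ∑ j, A t i j * w (d + 1) := by
                refine Finset.sum_le_sum fun j _ => ?_
                rcases le_or_gt (j : ℕ) d with h | h
                · rw [(hz1 j i h hi).2]; simp
                · exact mul_le_mul_of_nonneg_left (by exact_mod_cast ih2 j h) (hnn i j)
            _ = w (d + 1) := by rw [← Finset.sum_mul, hrow, one_mul]
        exact_mod_cast this
  let C : ℕ → Finset ℕ := fun t => (Finset.range (n - 1)).filter (fun d => ∃ s < t, Crs (A s) d)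
  have acc : ∀ t, underVar (fun i => (z t i : ℝ)) + η / 2 * ∑ d ∈ C t, (v d - v (d + 1)) ^ 2
      ≤ underVar (fun i => (z 0 i : ℝ)) := by
    intro t
    induction t with
    | zero => simp [C]
    | succ t ih =>
      let D := (Finset.range (n - 1)).filter (fun d => (∀ s < t, ¬ Crs (A s) d) ∧ Crs (A t) d)
      have hst := step hn (A t) (hA t) hη (z t) (z (t + 1)) (hz t) D (fun d => v d - v (d + 1))
        (pair_le v hv D (fun i => (z t i : ℝ))
          (fun d hd i hi => by
            have := (inv t d (Finset.mem_filter.1 hd).2.1).1 i hi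
            show (w d : ℝ) ≤ z t i
            exact_mod_cast this)
          (fun d hd i hi => by
            have := (inv t d (Finset.mem_filter.1 hd).2.1).2 i hi
            show (z t i : ℝ) ≤ w (d + 1)
            exact_mod_cast this))
        (fun d hd => (Finset.mem_filter.1 hd).2.2)
      have hU : C (t + 1) = C t ∪ D := by
        ext d
        simp only [C, D, Finset.mem_union, Finset.mem_filter]
        constructor
        · rintro ⟨h1, s, hs, h2⟩
          by_cases hh : ∃ s < t, Crs (A s) d
          · exact Or.inl ⟨h1, hh⟩
          · push Not at hh
            refine Or.inr ⟨h1, hh, ?_⟩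
            rcases Nat.lt_succ_iff_lt_or_eq.1 hs with h | h
            · exact absurd h2 (hh s h)
            · rwa [← h]
        · rintro (⟨h1, s, hs, h2⟩ | ⟨h1, _, h2⟩)
          · exact ⟨h1, s, by omega, h2⟩
          · exact ⟨h1, t, by omega, h2⟩
      have hdis : Disjoint (C t) D := by
        rw [Finset.disjoint_left]
        intro d h1 h2
        obtain ⟨s, hs, h3⟩ := (Finset.mem_filter.1 h1).2
        exact (Finset.mem_filter.1 h2).2.1 s hs h3
      rw [hU, Finset.sum_union hdis]
      linarith
  have hB := acc B
  have hfull : ∑ d ∈ C B, (v d - v (d + 1)) ^ 2 = ∑ d ∈ Finset.range (n - 1), (v d - v (d + 1)) ^ 2 := by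
    refine Finset.sum_subset (Finset.filter_subset _ _) fun d hd hnd => ?_
    have hd' := Finset.mem_range.1 hd
    have : v d = v (d + 1) := by
      rcases hcut ⟨d, by omega⟩ (by show d + 1 < n; omega) with h | ⟨t, ht, hc⟩
      · have a1 := hwi ⟨d, by omega⟩
        have a2 := hwi ⟨d + 1, by omega⟩
        show (w d : ℝ) = w (d + 1)
        have : w d = w (d + 1) := by
          have h' := h
          rw [← a1, ← a2] at h'
          exact h'
        exact_mod_cast this
      · exact absurd (Finset.mem_filter.2 ⟨hd, t, ht, hc⟩) hnd
    rw [this]; ring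
  rw [hfull] at hB
  set G := ∑ d ∈ Finset.range (n - 1), (v d - v (d + 1)) ^ 2 with hG
  have hnpos : (0 : ℝ) < n := by exact_mod_cast (by omega : 0 < n)
  have hG0 : 0 ≤ G := Finset.sum_nonneg fun _ _ => sq_nonneg _
  -- V ≤ n^2 G
  have hV : underVar (fun i => (z 0 i : ℝ)) ≤ n ^ 2 * G := by
    have tele : ∑ d ∈ Finset.range (n - 1), (v d - v (d + 1)) = v 0 - v (n - 1) :=
      Finset.sum_range_sub' v (n - 1)
    have cs := sq_sum_le_card_mul_sum_sq (s := Finset.range (n - 1)) (f := fun d => v d - v (d + 1))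
    rw [tele, Finset.card_range] at cs
    have cs' : (v 0 - v (n - 1)) ^ 2 ≤ n * G := by
      refine cs.trans ?_
      apply mul_le_mul_of_nonneg_right _ hG0
      exact_mod_cast Nat.sub_le n 1
    obtain ⟨i0, h0⟩ := inf_attained hn (fun i => (z 0 i : ℝ))
    have : underVar (fun i => (z 0 i : ℝ)) ≤ ∑ i : Fin n, (v 0 - v (n - 1)) ^ 2 := by
      unfold underVar
      refine Finset.sum_le_sum fun i _ => ?_
      apply pow_le_pow_left₀
      · have := inf_le' (fun i => (z 0 i : ℝ)) i
        linarith
      · rw [← h0]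
        have a1 : (z 0 i : ℝ) ≤ v 0 := by
          rw [← hwi]; exact hv (Nat.zero_le _)
        have a2 : v (n - 1) ≤ (z 0 i0 : ℝ) := by
          rw [← hwi]; exact hv (by have := i0.2; omega)
        linarith
    refine this.trans ?_
    rw [Finset.sum_const, Finset.card_univ, Fintype.card_fin, nsmul_eq_mul, pow_two (n : ℝ), mul_assoc]
    exact mul_le_mul_of_nonneg_left cs' hnpos.le
  have : η / (2 * n ^ 2) * underVar (fun i => (z 0 i : ℝ)) ≤ η / 2 * G := by
    calc η / (2 * n ^ 2) * underVar (fun i => (z 0 i : ℝ)) ≤ η / (2 * n ^ 2) * (n ^ 2 * G) :=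
          mul_le_mul_of_nonneg_left hV (by positivity)
      _ = η / 2 * G := by field_simp
  linarith

lemma underVar_perm {n : ℕ} (y : Fin n → ℝ) (σ : Equiv.Perm (Fin n)) :
    underVar (fun i => y (σ i)) = underVar y := by
  unfold underVar
  rw [σ.iInf_comp (g := y)]
  exact Equiv.sum_comp σ (fun i => (y i - ⨅ j, y j) ^ 2)

lemma good_perm {n : ℕ} {η : ℝ} (A : Matrix (Fin n) (Fin n) ℝ) (hA : GoodWeights η A)
    (σ : Equiv.Perm (Fin n)) : GoodWeights η (A.submatrix σ σ) := by
  obtain ⟨⟨hnn, hrow, hcol⟩, hdiag, hpos⟩ := hA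
  refine ⟨⟨fun i j => hnn _ _, fun i => ?_, fun j => ?_⟩, fun i => hdiag _, fun i j => hpos _ _⟩
  · rw [← hrow (σ i)]; exact Equiv.sum_comp σ (fun j => A (σ i) j)
  · rw [← hcol (σ j)]; exact Equiv.sum_comp σ (fun i => A i (σ j))

lemma underVar_int {n : ℕ} (hn : 2 ≤ n) (z : Fin n → ℤ) :
    ∃ m : ℤ, underVar (fun i => (z i : ℝ)) = m := by
  obtain ⟨i0, h0⟩ := inf_attained hn (fun i => (z i : ℝ))
  refine ⟨∑ i, (z i - z i0) ^ 2, ?_⟩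
  unfold underVar
  rw [← h0]
  push_cast
  rfl

lemma underVar_nonneg {n : ℕ} (y : Fin n → ℝ) : 0 ≤ underVar y :=
  Finset.sum_nonneg fun _ _ => sq_nonneg _

/-- There is an absolute constant `c > 0` such that, for the quantized
update under the standing assumptions, all components of `x(k)` are equal for all
`k ≥ c (n²/η) B log(Q² V̲(x(0)))`. -/
theorem stmt17 :
    ∃ c : ℝ, 0 < c ∧
      ∀ (n : ℕ), 2 ≤ n → ∀ (η : ℝ), 0 < η → ∀ (B : ℕ), 1 ≤ B → ∀ (Q : ℕ), 0 < Q →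
        ∀ (A : ℕ → Matrix (Fin n) (Fin n) ℝ), (∀ k, GoodWeights η (A k)) →
          ∀ (x : ℕ → Fin n → ℝ), (∀ i, ∃ m : ℤ, x 0 i = (m : ℝ) / Q) →
            0 < underVar (x 0) → 1 < (Q : ℝ) ^ 2 * underVar (x 0) →
              (∀ k i, x (k + 1) i = qfloor Q ((A k).mulVec (x k) i)) →
                (∀ k, CutConditionPerm A B k (x (k * B))) →
                  ∀ k : ℕ,
                    c * ((n : ℝ) ^ 2 / η) * B * Real.log ((Q : ℝ) ^ 2 * underVar (x 0)) ≤ k →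
                      ∀ i j, x k i = x k j := by
  refine ⟨3, by norm_num, ?_⟩
  intro n hn η hη B hB Q hQ A hA x hx0 hV0 hV1 hup hcut k hk
  have hQr : (0 : ℝ) < Q := by exact_mod_cast hQ
  have hex : ∀ k i, ∃ m : ℤ, x k i = (m : ℝ) / Q := by
    intro k
    cases k with
    | zero => exact hx0
    | succ k => exact fun i => ⟨_, hup k i⟩
  choose z hz using hex
  have hzx : ∀ k i, (z k i : ℝ) = Q * x k i := by
    intro k i; rw [hz]; field_simp
  have hstep : ∀ k i, z (k + 1) i = ⌊(A k).mulVec (fun j => (z k j : ℝ)) i⌋ := by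
    intro k i
    have h1 := hzx (k + 1) i
    rw [hup, qfloor, mul_div_cancel₀ _ hQr.ne'] at h1
    have h2 : (Q : ℝ) * (A k).mulVec (x k) i = (A k).mulVec (fun j => (z k j : ℝ)) i := by
      simp only [Matrix.mulVec, dotProduct, Finset.mul_sum, hzx]
      exact Finset.sum_congr rfl fun j _ => by ring
    rw [h2] at h1
    exact_mod_cast h1
  have hscale : (Q : ℝ) ^ 2 * underVar (x 0) = underVar (fun i => (z 0 i : ℝ)) := by
    unfold underVar
    simp only [hzx]
    rw [← Real.mul_iInf_of_nonneg hQr.le, Finset.mul_sum]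
    exact Finset.sum_congr rfl fun j _ => by ring
  rw [hscale] at hV1 hk
  let V : ℕ → ℝ := fun t => underVar (fun i => (z t i : ℝ))
  have hVint : ∀ t, ∃ m : ℤ, V t = m := fun t => underVar_int hn (z t)
  have hVnn : ∀ t, 0 ≤ V t := fun t => underVar_nonneg _
  have hmono : Antitone V := by
    apply antitone_nat_of_succ_le
    intro t
    have := step hn (A t) (hA t) hη (z t) (z (t + 1)) (hstep t) ∅ (fun _ => 0)
      (fun i j => by simp; positivity) (by simp)
    simpa using this
  have hblock : ∀ K, V ((K + 1) * B) ≤ (1 - η / (2 * n ^ 2)) * V (K * B) := by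
    intro K
    obtain ⟨σ, hσ, hc⟩ := hcut K
    have hb := block hn hη B (fun t => (A (K * B + t)).submatrix σ σ)
      (fun t => good_perm _ (hA _) σ) (fun t i => z (K * B + t) (σ i))
      (fun t i => by
        show z (K * B + t + 1) (σ i) = _
        rw [hstep]
        congr 1
        exact (Equiv.sum_comp σ (fun j => A (K * B + t) (σ i) j * (z (K * B + t) j : ℝ))).symm)
      (fun i j hij => by
        have h1 := hσ hij
        simp only [Function.comp] at h1
        have h2 : (z (K * B) (σ j) : ℝ) ≤ z (K * B) (σ i) := by
          rw [hzx, hzx]; exact mul_le_mul_of_nonneg_left h1 hQr.le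
        exact_mod_cast h2)
      (fun d h => by
        rcases hc d h with h1 | ⟨t, ht1, ht2, i, j, hi, hj, hA'⟩
        · left
          have h2 : (z (K * B) (σ d) : ℝ) = z (K * B) (σ ⟨(d : ℕ) + 1, h⟩) := by
            rw [hzx, hzx, h1]
          exact_mod_cast h2
        · right
          refine ⟨t - K * B, ?_, i, j, hi, hj, ?_⟩
          · rw [add_mul] at ht2; omega
          · simp only [Matrix.submatrix_apply]
            rwa [Nat.add_sub_cancel' ht1])
    have e1 := underVar_perm (fun i => (z (K * B + B) i : ℝ)) σ
    have e2 := underVar_perm (fun i => (z (K * B + 0) i : ℝ)) σ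
    show underVar (fun i => (z ((K + 1) * B) i : ℝ)) ≤ _ * underVar (fun i => (z (K * B) i : ℝ))
    rw [show (K + 1) * B = K * B + B by ring, ← e1]
    refine hb.trans (le_of_eq ?_)
    rw [e2]
    rfl
  have hη1 : η ≤ 1 := by
    obtain ⟨⟨hnn, hrow, hcol⟩, hdiag, hpos⟩ := hA 0
    let i : Fin n := ⟨0, by omega⟩
    have h1 := hpos i i (hdiag i)
    have h2 := Finset.single_le_sum (f := fun j => A 0 i j) (fun j _ => hnn i j) (Finset.mem_univ i)
    rw [hrow] at h2
    exact h1.trans h2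
  have hn2 : (2 : ℝ) ≤ n := by exact_mod_cast hn
  have hexp : ∀ K : ℕ, V (K * B) ≤ Real.exp (-(K * (η / (2 * n ^ 2)))) * V 0 := by
    intro K
    induction K with
    | zero => simp
    | succ K ih =>
      refine (hblock K).trans ?_
      have e1 : 1 - η / (2 * n ^ 2) ≤ Real.exp (-(η / (2 * n ^ 2))) := by
        have := Real.add_one_le_exp (-(η / (2 * (n : ℝ) ^ 2)))
        linarith
      calc (1 - η / (2 * n ^ 2)) * V (K * B) ≤ Real.exp (-(η / (2 * n ^ 2))) * V (K * B) :=
            mul_le_mul_of_nonneg_right e1 (hVnn _)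
        _ ≤ Real.exp (-(η / (2 * n ^ 2))) * (Real.exp (-(K * (η / (2 * n ^ 2)))) * V 0) :=
            mul_le_mul_of_nonneg_left ih (Real.exp_pos _).le
        _ = _ := by
            rw [← mul_assoc, ← Real.exp_add]
            congr 2
            push_cast
            ring
  have hV2 : 2 ≤ V 0 := by
    obtain ⟨m, hm⟩ := hVint 0
    have h1 : (1 : ℝ) < m := by rw [← hm]; exact hV1
    rw [hm]
    have h2 : (1 : ℤ) < m := by exact_mod_cast h1
    exact_mod_cast h2
  have hlog : 0.69 ≤ Real.log (V 0) := by
    have h1 := Real.log_le_log (by norm_num) hV2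
    have h2 := Real.log_two_gt_d9
    linarith
  have hBr : (0 : ℝ) < B := by exact_mod_cast hB
  set L := Real.log (V 0) with hL
  have hN : 4 ≤ (n : ℝ) ^ 2 / η := by
    rw [le_div_iff₀ hη]; nlinarith
  set N := (n : ℝ) ^ 2 / η with hNdef
  have hKlt : 2 * N * L < ((k / B : ℕ) : ℝ) := by
    have h1 : k < (k / B + 1) * B := by
      have := Nat.lt_div_mul_add (a := k) hB
      rw [add_mul]; omega
    have h2 : (k : ℝ) < (((k / B : ℕ) : ℝ) + 1) * B := by exact_mod_cast h1
    have h3 : 3 * N * L * B < (((k / B : ℕ) : ℝ) + 1) * B := by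
      refine lt_of_le_of_lt ?_ h2
      calc 3 * N * L * B = 3 * N * B * L := by ring
        _ ≤ k := hk
    have h4 := lt_of_mul_lt_mul_right h3 hBr.le
    nlinarith
  have hVk : V k < 1 := by
    refine (hmono (Nat.div_mul_le_self k B)).trans_lt ((hexp _).trans_lt ?_)
    have h5 : V 0 = Real.exp L := (Real.exp_log (by linarith)).symm
    rw [h5, ← Real.exp_add, Real.exp_lt_one_iff]
    have h6 : η / (2 * (n : ℝ) ^ 2) = 1 / (2 * N) := by
      rw [hNdef]; field_simp
    have hNp : 0 < 2 * N := by linarith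
    rw [h6, mul_one_div]
    have : L < ((k / B : ℕ) : ℝ) / (2 * N) := by
      rw [lt_div_iff₀ hNp]; linarith
    linarith
  have hVk0 : V k = 0 := by
    obtain ⟨m, hm⟩ := hVint k
    have h1 := hVnn k
    rw [hm] at hVk h1 ⊢
    have h2 : m < 1 := by exact_mod_cast hVk
    have h3 : 0 ≤ m := by exact_mod_cast h1
    have : m = 0 := by omega
    simp [this]
  have hall : ∀ i, (z k i : ℝ) = ⨅ j, (z k j : ℝ) := by
    intro i
    have := (Finset.sum_eq_zero_iff_of_nonneg (fun i _ => sq_nonneg _)).1 hVk0 i (Finset.mem_univ i)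
    have := pow_eq_zero_iff (two_ne_zero) |>.1 this
    linarith
  intro i j
  rw [hz k i, hz k j, hall i, hall j]
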